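/- Let k be a field of characteristic 0, E a finite étale k-algebra, V an E-module, and φ : V × V → k a k-bilinear form satisfying φ(e·v, w) = φ(v, e·w) for all e ∈ E and v, w ∈ V. Let φ̃ : V × V → E be the unique E-bilinear form with φ(v,w) = Tr_{E/k}(φ̃(v,w)) for all v, w ∈ V. Then: φ is symmetric if and only if φ̃ is symmetric, and φ is alternating (φ(v,v) = 0 for all v) if and only if φ̃ is alternating. -/

import Mathlib

/-- Every element of a reduced commutative Artinian ring is von Neumann regular. -/
theorem IsReduced.exists_mul_mul_self_eq {R : Type*} [CommRing R] [IsReduced R] [IsArtinianRing R]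
    (x : R) : ∃ y, x * y * x = x := by
  obtain ⟨n, y, hy⟩ := IsArtinian.exists_pow_succ_smul_dvd x (1 : R)
  refine ⟨y, ?_⟩
  have hnil : (x - x * y * x) ^ (n + 1) = 0 := by
    have h : x ^ n * (1 - x * y) = 0 := by
      simp only [smul_eq_mul, mul_one, Nat.succ_eq_add_one] at hy
      linear_combination -hy
    calc (x - x * y * x) ^ (n + 1) = x ^ n * (1 - x * y) * (x * (1 - x * y) ^ n) := by
          rw [show x - x * y * x = x * (1 - x * y) by ring, mul_pow]; ring
      _ = 0 := by rw [h, zero_mul]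
  exact (sub_eq_zero.mp (_root_.pow_eq_zero_iff n.succ_ne_zero |>.mp hnil)).symm

/-- In characteristic zero, an idempotent of trace zero in a finite algebra vanishes. -/
theorem IsIdempotentElem.eq_zero_of_trace_eq_zero {k E : Type*} [Field k] [CharZero k]
    [CommRing E] [Algebra k E] [Module.Finite k E] {e : E} (he : IsIdempotentElem e)
    (htr : Algebra.trace k E e = 0) : e = 0 := by
  rw [Algebra.trace_apply] at htr
  have hlmul := LinearMap.IsIdempotentElem.eq_zero_of_trace_eq_zero (he.map (Algebra.lmul k E)) htr
  simpa using LinearMap.congr_fun hlmul 1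

/-- The trace form of a finite reduced algebra over a field of characteristic zero is
nondegenerate. -/
theorem Algebra.eq_zero_of_forall_trace_mul_eq_zero {k E : Type*} [Field k] [CharZero k]
    [CommRing E] [Algebra k E] [IsReduced E] [Module.Finite k E] {x : E}
    (h : ∀ e, Algebra.trace k E (e * x) = 0) : x = 0 := by
  have : IsArtinianRing E := IsArtinianRing.of_finite k E
  obtain ⟨y, hy⟩ := IsReduced.exists_mul_mul_self_eq x
  have hidem : IsIdempotentElem (y * x) := by
    rw [IsIdempotentElem]; linear_combination y * hy
  have hzero := hidem.eq_zero_of_trace_eq_zero (h y)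
  linear_combination x * hzero - hy

/-- Let `k` be a field of characteristic `0`, `E` a finite étale `k`-algebra (i.e. a nonzero
finite-dimensional commutative reduced `k`-algebra), `V` an `E`-module, and `φ : V × V → k` a
`k`-bilinear form satisfying `φ(e•v, w) = φ(v, e•w)`.  Let `φ̃ : V × V → E` be the (unique)
`E`-bilinear form with `φ(v,w) = Tr_{E/k}(φ̃(v,w))`.  Then `φ` is symmetric iff `φ̃` is
symmetric, and `φ` is alternating iff `φ̃` is alternating. -/
theorem bilinear_lift_symm_iff_and_alternating_iff
    (k : Type*) [Field k] [CharZero k]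
    (E : Type*) [CommRing E] [Algebra k E] [Nontrivial E] [IsReduced E] [Module.Finite k E]
    (V : Type*) [AddCommGroup V] [Module E V] [Module k V] [IsScalarTower k E V]
    (φ : V →ₗ[k] V →ₗ[k] k)
    (hcompat : ∀ (e : E) (v w : V), φ (e • v) w = φ v (e • w))
    (φt : V →ₗ[E] V →ₗ[E] E)
    (htrace : ∀ v w : V, φ v w = Algebra.trace k E (φt v w)) :
    ((∀ v w : V, φ v w = φ w v) ↔ (∀ v w : V, φt v w = φt w v)) ∧
      ((∀ v : V, φ v v = 0) ↔ (∀ v : V, φt v v = 0)) := by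
  have htrace_mul (e : E) (v w : V) : Algebra.trace k E (e * φt v w) = φ (e • v) w := by
    rw [htrace, map_smul, LinearMap.smul_apply, smul_eq_mul]
  refine ⟨⟨fun hsymm v w => ?_, fun hsymm v w => ?_⟩, ⟨fun halt v => ?_, fun halt v => ?_⟩⟩
  · rw [← sub_eq_zero]
    refine Algebra.eq_zero_of_forall_trace_mul_eq_zero (k := k) fun e => ?_
    rw [mul_sub, map_sub, htrace_mul, htrace_mul, hcompat, hsymm, sub_self]
  · rw [htrace, hsymm, ← htrace]
  · refine Algebra.eq_zero_of_forall_trace_mul_eq_zero (k := k) fun e => ?_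
    have hneg : -φ (e • v) v = φ v (e • v) := LinearMap.IsAlt.neg halt (e • v) v
    rw [htrace_mul]
    exact self_eq_neg.mp ((hcompat e v v).trans hneg.symm)
  · rw [htrace, halt, map_zero]
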